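/- In case (a): if l = 2n/k is even, then the subgroup ⟨φ_ξ^+, ψ_c^+⟩ of Aut(R) is isomorphic to the dihedral group D_{2k} = ⟨r, s : r² = s^{2k} = (rs)² = 1⟩ of order 4k, with ψ_c^+ of order 2, φ_ξ^+ of order 2k, and ψ_c^+ φ_ξ^+ (ψ_c^+)^{-1} = (φ_ξ^+)^{-1}; if l is odd, then ⟨φ_ξ^+⟩ is a normal subgroup, ψ_c^+ φ_ξ^+ (ψ_c^+)^{-1} = (φ_ξ^+)^{k-1}, and ⟨φ_ξ^+, ψ_c^+⟩ is isomorphic to 𝕌_k = ⟨x, y : x² = y^{2k} = 1, x y x y^{k+1} = 1⟩. -/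

import Mathlib

open scoped BigOperators

noncomputable section

/-- The hyperelliptic ring `R = ℂ[t,t⁻¹,u : u² = p(t)]`, realized as
`ℂ[t,t⁻¹][X]/(X² - p)`. -/
abbrev HypRing (p : LaurentPolynomial ℂ) : Type :=
  AdjoinRoot (Polynomial.X ^ 2 - Polynomial.C p)

/-- The element `t^i` of `R`, for `i : ℤ`. -/
noncomputable def tP (p : LaurentPolynomial ℂ) (i : ℤ) : HypRing p :=
  AdjoinRoot.of _ (LaurentPolynomial.T i)

/-- The element `u` of `R`. -/
noncomputable def uE (p : LaurentPolynomial ℂ) : HypRing p := AdjoinRoot.root _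

/-- The module of Kähler differentials `Ω_R` of `R` over `ℂ`. -/
abbrev HypOmega (p : LaurentPolynomial ℂ) := KaehlerDifferential ℂ (HypRing p)

/-- The subspace `dR ⊆ Ω_R` of exact differentials. -/
noncomputable def dSub (p : LaurentPolynomial ℂ) : Submodule ℂ (HypOmega p) :=
  LinearMap.range (KaehlerDifferential.D ℂ (HypRing p)).toLinearMap

/-- The quotient `Ω_R/dR`. -/
abbrev HypCenter (p : LaurentPolynomial ℂ) := HypOmega p ⧸ dSub p

/-- The class `\overline{f dg}` of `f dg` in `Ω_R/dR`. -/
noncomputable def cls (p : LaurentPolynomial ℂ) (f g : HypRing p) : HypCenter p :=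
  Submodule.Quotient.mk (f • (KaehlerDifferential.D ℂ (HypRing p) g))

/-- `ω₀ = \overline{t⁻¹ dt}` and `ω_k = \overline{t^{-k} u dt}` for `k ≥ 1`. -/
noncomputable def om (p : LaurentPolynomial ℂ) (k : ℕ) : HypCenter p :=
  if k = 0 then cls p (tP p (-1)) (tP p 1)
  else cls p (tP p (-(k : ℤ)) * uE p) (tP p 1)
/-- The group `𝕌_k = ⟨x, y : x² = y^{2k} = 1, xyxy^{k+1} = 1⟩`. -/
def URels (k : ℕ) : Set (FreeGroup (Fin 2)) :=
  {FreeGroup.of 0 ^ 2, FreeGroup.of 1 ^ (2 * k),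
    FreeGroup.of 0 * FreeGroup.of 1 * FreeGroup.of 0 * FreeGroup.of 1 ^ (k + 1)}

abbrev UGroup (k : ℕ) := PresentedGroup (URels k)

/-- If `x ^ 2 = 1` and `x` conjugates `y` into `⟨y⟩`, then `x` and `y` normalize `⟨y⟩`. -/
theorem closure_pair_le_normalizer_zpowers {G : Type*} [Group G] {x y : G} (hx : x ^ 2 = 1)
    (hxy : x * y * x⁻¹ ∈ Subgroup.zpowers y) :
    Subgroup.closure {y, x} ≤ Subgroup.normalizer (Subgroup.zpowers y : Set G) := by
  have hinv : x⁻¹ = x := inv_eq_of_mul_eq_one_left (by rw [← sq, hx])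
  have hconj : ∀ h ∈ Subgroup.zpowers y, x * h * x⁻¹ ∈ Subgroup.zpowers y := by
    rintro _ ⟨i, rfl⟩
    simpa only [conj_zpow] using Subgroup.zpow_mem _ hxy i
  rw [Subgroup.closure_le]
  rintro g (rfl | rfl)
  · exact Subgroup.le_normalizer (Subgroup.mem_zpowers g)
  · rw [SetLike.mem_coe, Subgroup.mem_normalizer_iff]
    refine fun h => ⟨hconj h, fun hh => ?_⟩
    have := hconj _ hh
    rw [hinv] at this
    have e : g * (g * h * g) * g = g ^ 2 * h * g ^ 2 := by simp only [sq, mul_assoc]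
    rw [e, hx] at this
    simpa using this

/-- A group generated by an involution `x` and an element `y` with `y ^ N = 1` and `⟨y⟩` normalized
by `x` embeds along any homomorphism that keeps the order `N` of `y` and maps `x` outside the image
of `⟨y⟩`. -/
theorem closure_pair_equiv_of_map {G H : Type*} [Group G] [Group H] (f : H →* G) {x y : H} {N : ℕ}
    (hgen : Subgroup.closure {y, x} = ⊤) (hx : x ^ 2 = 1) (hy : y ^ N = 1)
    (hxy : x * y * x⁻¹ ∈ Subgroup.zpowers y) {x' y' : G} (hfx : f x = x') (hfy : f y = y')
    (hord : orderOf y' = N) (hnot : x' ∉ Subgroup.zpowers y') :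
    Nonempty (↥(Subgroup.closure {y', x'}) ≃* H) := by
  subst hfx hfy
  have hnorm : (Subgroup.zpowers y).Normal := by
    rw [← Subgroup.normalizer_eq_top_iff, eq_top_iff, ← hgen]
    exact closure_pair_le_normalizer_zpowers hx hxy
  have hinj : Function.Injective f := by
    rw [injective_iff_map_eq_one]
    intro h hh
    have hmem : h ∈ Subgroup.zpowers x ⊔ Subgroup.zpowers y := by
      rw [Subgroup.zpowers_eq_closure, Subgroup.zpowers_eq_closure, ← Subgroup.closure_union,
        Set.singleton_union, Set.pair_comm, hgen]
      trivial
    rw [Subgroup.mem_sup_of_normal_right] at hmem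
    obtain ⟨_, ⟨i, rfl⟩, _, ⟨j, rfl⟩, rfl⟩ := hmem
    have hy' : f y ^ j = 1 → y ^ j = 1 := fun h1 => by
      rw [← orderOf_dvd_iff_zpow_eq_one, hord] at h1
      obtain ⟨m, rfl⟩ := h1
      rw [zpow_mul, zpow_natCast, hy, one_zpow]
    have hx2 : ∀ m : ℤ, x ^ (m + m) = 1 := fun m => by
      rw [← two_mul, zpow_mul]
      norm_cast
      rw [hx, one_zpow]
    rcases Int.even_or_odd' i with ⟨m, rfl | rfl⟩
    · simp only [two_mul, hx2, one_mul, map_zpow] at hh ⊢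
      exact hy' hh
    · exfalso
      simp only [two_mul, zpow_add_one, hx2, one_mul, map_mul, map_zpow] at hh
      exact hnot ⟨-j, by simpa using (eq_inv_of_mul_eq_one_left hh).symm⟩
  have hrange : f.range = Subgroup.closure {f y, f x} := by
    rw [MonoidHom.range_eq_map, ← hgen, MonoidHom.map_closure, Set.image_pair]
  rw [← hrange]
  exact ⟨(MonoidHom.ofInjective hinj).symm⟩

/-- The homomorphism from a dihedral group sending `r i` to `y ^ i` and `sr i` to `x * y ^ i`. -/
def dihedralHom {G : Type*} [Group G] (N : ℕ) (x y : G) (hx : x ^ 2 = 1) (hy : y ^ N = 1)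
    (hxy : x * y * x⁻¹ = y⁻¹) : DihedralGroup N →* G :=
  let g : ZMod N →+ Additive G :=
    ZMod.lift N ⟨zmultiplesHom (Additive G) (Additive.ofMul y), by simp [← ofMul_pow, hy]⟩
  have hadd : ∀ i j : ZMod N, (g (i + j)).toMul = (g i).toMul * (g j).toMul := fun i j => by
    rw [map_add, toMul_add]
  have hconj : ∀ i : ZMod N, (g i).toMul * x = x * (g (-i)).toMul := by
    intro i
    obtain ⟨j, rfl⟩ := ZMod.intCast_surjective i
    rw [← Int.cast_neg]
    have e : ∀ m : ℤ, (g (m : ZMod N)).toMul = y ^ m := fun m => by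
      simp [g, toMul_zsmul]
    rw [e, e, zpow_neg, ← inv_zpow, ← hxy, conj_zpow]
    have hinv : x⁻¹ = x := inv_eq_of_mul_eq_one_left (by rw [← sq, hx])
    rw [hinv, ← mul_assoc, ← mul_assoc, ← sq, hx, one_mul]
  MonoidHom.mk'
    (fun d => match d with
      | .r i => (g i).toMul
      | .sr i => x * (g i).toMul)
    (by
      have hxx : ∀ z : G, x * (x * z) = z := fun z => by rw [← mul_assoc, ← sq, hx, one_mul]
      have hsub : ∀ i j : ZMod N, (g (j - i)).toMul = (g (-i)).toMul * (g j).toMul := fun i j => by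
        rw [← hadd, neg_add_eq_sub]
      rintro (i | i) (j | j)
      · exact hadd i j
      · change x * (g (j - i)).toMul = (g i).toMul * (x * (g j).toMul)
        rw [hsub, ← mul_assoc, ← mul_assoc, hconj]
      · change x * (g (i + j)).toMul = x * (g i).toMul * (g j).toMul
        rw [hadd, mul_assoc]
      · change (g (j - i)).toMul = x * (g i).toMul * (x * (g j).toMul)
        rw [hsub, mul_assoc, ← mul_assoc (g i).toMul, hconj, mul_assoc, hxx])

theorem dihedralHom_r_one {G : Type*} [Group G] (N : ℕ) (x y : G) (hx : x ^ 2 = 1)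
    (hy : y ^ N = 1) (hxy : x * y * x⁻¹ = y⁻¹) :
    dihedralHom N x y hx hy hxy (DihedralGroup.r 1) = y := by
  change (ZMod.lift N _ (1 : ZMod N) : Additive G).toMul = y
  rw [← Int.cast_one, ZMod.lift_coe]
  simp

theorem dihedralHom_sr_zero {G : Type*} [Group G] (N : ℕ) (x y : G) (hx : x ^ 2 = 1)
    (hy : y ^ N = 1) (hxy : x * y * x⁻¹ = y⁻¹) :
    dihedralHom N x y hx hy hxy (DihedralGroup.sr 0) = x := by
  change x * (ZMod.lift N _ (0 : ZMod N) : Additive G).toMul = x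
  rw [map_zero, toMul_zero, mul_one]

theorem closure_r_one_sr_zero (N : ℕ) :
    Subgroup.closure {DihedralGroup.r 1, DihedralGroup.sr 0} =
      (⊤ : Subgroup (DihedralGroup N)) := by
  rw [eq_top_iff]
  have hr : ∀ i : ZMod N, DihedralGroup.r i ∈
      Subgroup.closure {DihedralGroup.r 1, DihedralGroup.sr (0 : ZMod N)} := fun i => by
    obtain ⟨j, rfl⟩ := ZMod.intCast_surjective i
    rw [← DihedralGroup.r_one_zpow]
    exact Subgroup.zpow_mem _ (Subgroup.subset_closure (by simp)) _
  rintro (i | i) -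
  · exact hr i
  · have : DihedralGroup.sr i = DihedralGroup.sr 0 * DihedralGroup.r i := by simp
    rw [this]
    exact Subgroup.mul_mem _ (Subgroup.subset_closure (by simp)) (hr i)

theorem nonempty_closure_pair_mulEquiv_dihedralGroup {G : Type*} [Group G] {N : ℕ} {x y : G}
    (hx : x ^ 2 = 1) (hy : orderOf y = N) (hxy : x * y * x⁻¹ = y⁻¹)
    (hnot : x ∉ Subgroup.zpowers y) :
    Nonempty (↥(Subgroup.closure {y, x}) ≃* DihedralGroup N) := by
  have hyN : y ^ N = 1 := hy ▸ pow_orderOf_eq_one y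
  exact closure_pair_equiv_of_map (dihedralHom N x y hx hyN hxy) (N := N)
    (closure_r_one_sr_zero N) (by simp [sq]) (by simp) ⟨-1, by simp⟩
    (dihedralHom_sr_zero ..) (dihedralHom_r_one ..) hy hnot

theorem nonempty_closure_pair_mulEquiv_UGroup {G : Type*} [Group G] {k : ℕ} {x y : G}
    (hx : x ^ 2 = 1) (hy : orderOf y = 2 * k) (hxy : x * y * x * y ^ (k + 1) = 1)
    (hnot : x ∉ Subgroup.zpowers y) :
    Nonempty (↥(Subgroup.closure {y, x}) ≃* UGroup k) := by
  have hyN : y ^ (2 * k) = 1 := hy ▸ pow_orderOf_eq_one y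
  have hrel : ∀ r ∈ URels k, FreeGroup.lift ![x, y] r = 1 := by
    rintro r (rfl | rfl | rfl) <;> simp [hx, hyN, hxy]
  have hone : ∀ r ∈ URels k, PresentedGroup.mk (URels k) r = 1 := fun r hr =>
    PresentedGroup.one_of_mem hr
  have h0 : (PresentedGroup.of 0 : UGroup k) ^ 2 = 1 := by
    exact hone (FreeGroup.of 0 ^ 2) (by simp [URels])
  have h1 : (PresentedGroup.of 1 : UGroup k) ^ (2 * k) = 1 := by
    exact hone (FreeGroup.of 1 ^ (2 * k)) (by simp [URels])
  have h2 : (PresentedGroup.of 0 : UGroup k) * PresentedGroup.of 1 * PresentedGroup.of 0 *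
      PresentedGroup.of 1 ^ (k + 1) = 1 := by
    exact hone (FreeGroup.of 0 * FreeGroup.of 1 * FreeGroup.of 0 *
      FreeGroup.of 1 ^ (k + 1)) (by simp [URels])
  have hinv : (PresentedGroup.of 0 : UGroup k)⁻¹ = PresentedGroup.of 0 :=
    inv_eq_of_mul_eq_one_left (by rw [← sq, h0])
  have hgen : Subgroup.closure {PresentedGroup.of 1, PresentedGroup.of 0} =
      (⊤ : Subgroup (UGroup k)) := by
    rw [← PresentedGroup.closure_range_of, ← Set.image_univ]
    congr 1
    ext z
    simp [Fin.exists_fin_two, eq_comm, or_comm]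
  exact closure_pair_equiv_of_map (PresentedGroup.toGroup hrel) hgen h0 h1
    ⟨-((k + 1 : ℕ) : ℤ), by
      simp only [hinv, zpow_neg, zpow_natCast]
      exact (eq_inv_of_mul_eq_one_left h2).symm⟩
    (PresentedGroup.toGroup.of hrel) (PresentedGroup.toGroup.of hrel) hy hnot

theorem monic_X_sq_sub_C (p : LaurentPolynomial ℂ) :
    (Polynomial.X ^ 2 - Polynomial.C p).Monic :=
  Polynomial.monic_X_pow_sub_C p two_ne_zero

theorem hypRing_of_injective (p : LaurentPolynomial ℂ) :
    Function.Injective (AdjoinRoot.of (Polynomial.X ^ 2 - Polynomial.C p)) := by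
  rw [injective_iff_map_eq_zero]
  intro a ha
  by_contra h0
  refine AdjoinRoot.mk_ne_zero_of_natDegree_lt (monic_X_sq_sub_C p)
    (Polynomial.C_ne_zero.2 h0) ?_ ha
  rw [Polynomial.natDegree_X_pow_sub_C, Polynomial.natDegree_C]
  exact two_pos

theorem uE_ne_zero (p : LaurentPolynomial ℂ) : uE p ≠ 0 := by
  refine AdjoinRoot.mk_ne_zero_of_natDegree_lt (monic_X_sq_sub_C p) Polynomial.X_ne_zero ?_
  rw [Polynomial.natDegree_X_pow_sub_C, Polynomial.natDegree_X]
  exact one_lt_two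

theorem tP_add (p : LaurentPolynomial ℂ) (i j : ℤ) : tP p (i + j) = tP p i * tP p j := by
  rw [tP, LaurentPolynomial.T_add, map_mul]; rfl

theorem tP_zero (p : LaurentPolynomial ℂ) : tP p 0 = 1 := by
  rw [tP, LaurentPolynomial.T_zero, map_one]

theorem hypRing_algEquiv_ext {p : LaurentPolynomial ℂ} {f g : HypRing p ≃ₐ[ℂ] HypRing p}
    (ht : f (tP p 1) = g (tP p 1)) (hu : f (uE p) = g (uE p)) : f = g := by
  have hinv : f (tP p (-1)) = g (tP p (-1)) := by
    refine left_inv_eq_right_inv (a := f (tP p 1)) ?_ ?_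
    · rw [← map_mul, ← tP_add, neg_add_cancel, tP_zero, map_one]
    · rw [ht, ← map_mul, ← tP_add, add_neg_cancel, tP_zero, map_one]
  have hT : ∀ m : ℤ, f (tP p m) = g (tP p m) := by
    intro m
    induction m with
    | zero => simp [tP_zero]
    | succ m ih => rw [tP_add, map_mul, map_mul, ih, ht]
    | pred m ih => rw [sub_eq_add_neg (-(m : ℤ)), tP_add, map_mul, map_mul, ih, hinv]
  have hL : ∀ a : LaurentPolynomial ℂ, f (AdjoinRoot.of _ a) = g (AdjoinRoot.of _ a) := by
    intro a
    induction a using LaurentPolynomial.induction_on' with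
    | add a b ha hb => rw [map_add, map_add, map_add, ha, hb]
    | C_mul_T m a =>
      have hs : AdjoinRoot.of (Polynomial.X ^ 2 - Polynomial.C p)
          (LaurentPolynomial.C a * LaurentPolynomial.T m) = algebraMap ℂ (HypRing p) a * tP p m := by
        rw [map_mul]; rfl
      rw [hs, map_mul, map_mul, hT, AlgEquiv.commutes, AlgEquiv.commutes]
  ext x
  induction x using AdjoinRoot.induction_on with
  | ih q =>
    induction q using Polynomial.induction_on' with
    | add a b ha hb => rw [map_add, map_add, map_add, ha, hb]
    | monomial m a =>
      have hs : AdjoinRoot.mk (Polynomial.X ^ 2 - Polynomial.C p) (Polynomial.monomial m a) =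
          AdjoinRoot.of _ a * uE p ^ m := by
        rw [← Polynomial.C_mul_X_pow_eq_monomial, map_mul, map_pow]; rfl
      rw [hs, map_mul, map_mul, map_pow, map_pow, hL, hu]

/-- An automorphism sending `t` to `a t^e` sends `t^m` to `a^m t^{em}`. -/
theorem algEquiv_tP {p : LaurentPolynomial ℂ} {f : HypRing p ≃ₐ[ℂ] HypRing p} {a : ℂ} (ha : a ≠ 0)
    {e : ℤ} (h : f (tP p 1) = a • tP p e) (m : ℤ) : f (tP p m) = a ^ m • tP p (e * m) := by
  have hinv : f (tP p (-1)) = a⁻¹ • tP p (-e) := by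
    refine left_inv_eq_right_inv (a := f (tP p 1)) ?_ ?_
    · rw [← map_mul, ← tP_add, neg_add_cancel, tP_zero, map_one]
    · rw [h, smul_mul_smul_comm, ← tP_add, add_neg_cancel, tP_zero, mul_inv_cancel₀ ha, one_smul]
  induction m with
  | zero => simp [tP_zero]
  | succ m ih =>
    rw [tP_add, map_mul, ih, h, smul_mul_smul_comm, ← tP_add, zpow_add_one₀ ha, mul_add, mul_one]
  | pred m ih =>
    rw [sub_eq_add_neg (-(m : ℤ)), tP_add, map_mul, ih, hinv, smul_mul_smul_comm, ← tP_add,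
      ← sub_eq_add_neg (-(m : ℤ)), zpow_sub_one₀ ha, mul_sub, mul_one, sub_eq_add_neg (e * _)]

/-- In case (a): if `l = 2n/k` is even then `⟨φ_ξ^+, ψ_c^+⟩ ≅ D_{2k}` (dihedral of order `4k`),
with `ψ_c^+` of order 2, `φ_ξ^+` of order `2k` and `ψ_c^+ φ_ξ^+ (ψ_c^+)⁻¹ = (φ_ξ^+)⁻¹`;
if `l` is odd then `⟨φ_ξ^+⟩` is normal, `ψ_c^+ φ_ξ^+ (ψ_c^+)⁻¹ = (φ_ξ^+)^{k-1}`, and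
`⟨φ_ξ^+, ψ_c^+⟩ ≅ 𝕌_k`. -/
theorem dihedral_group_structure_case_a (n k l : ℕ) (hn : 1 ≤ n) (hk : 1 ≤ k)
    (hl : k * l = 2 * n)
    (α : Fin (2 * n) → ℂ) (hα0 : ∀ i, α i ≠ 0) (hαinj : Function.Injective α)
    (p : LaurentPolynomial ℂ)
    (hp : p = LaurentPolynomial.T 1 *
      ∏ i : Fin (2 * n), (LaurentPolynomial.T 1 - LaurentPolynomial.C (α i)))
    (ζ : ℂ) (hζ : IsPrimitiveRoot ζ k)
    (γ : Equiv.Perm (Fin (2 * n))) (hγ : ∀ i, α (γ i) = ζ * α i)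
    (ξ : ℂ) (hξ : ξ = Complex.exp (2 * Real.pi * Complex.I / (2 * k)))
    (hξ2 : ξ ^ 2 = ζ)
    (c : ℂ) (hc : c ≠ 0)
    (β : Equiv.Perm (Fin (2 * n))) (hβ : ∀ i, α i * α (β i) = c ^ 2)
    (ha1 : ∏ i : Fin (2 * n), α i = c ^ (2 * n))
    (φp : HypRing p ≃ₐ[ℂ] HypRing p)
    (hφt : φp (tP p 1) = ξ ^ 2 • tP p 1) (hφu : φp (uE p) = ξ • uE p)
    (ψp : HypRing p ≃ₐ[ℂ] HypRing p)
    (hψt : ψp (tP p 1) = c ^ 2 • tP p (-1))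
    (hψu : ψp (uE p) = c ^ (n + 1) • (tP p (-(n : ℤ) - 1) * uE p)) :
    (Even l →
      orderOf ψp = 2 ∧ orderOf φp = 2 * k ∧
      ψp * φp * ψp⁻¹ = φp⁻¹ ∧
      Nonempty (↥(Subgroup.closure {φp, ψp}) ≃* DihedralGroup (2 * k))) ∧
    (Odd l →
      ψp * φp * ψp⁻¹ = φp ^ (k - 1) ∧
      ((Subgroup.zpowers φp).subgroupOf (Subgroup.closure {φp, ψp})).Normal ∧
      Nonempty (↥(Subgroup.closure {φp, ψp}) ≃* UGroup k)) := by
  have hξprim : IsPrimitiveRoot ξ (2 * k) := by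
    have := Complex.isPrimitiveRoot_exp (2 * k) (by omega)
    rw [hξ]
    exact_mod_cast this
  have hξ0 : ξ ≠ 0 := hξprim.ne_zero (by omega)
  have hφpow : ∀ m : ℕ, (φp ^ m) (tP p 1) = (ξ ^ 2) ^ m • tP p 1 ∧
      (φp ^ m) (uE p) = ξ ^ m • uE p := by
    intro m
    induction m with
    | zero => simp
    | succ m ih =>
      rw [pow_succ' φp, AlgEquiv.mul_apply, AlgEquiv.mul_apply, ih.1, ih.2, map_smul, map_smul, hφt,
        hφu, smul_smul, smul_smul, ← pow_succ, ← pow_succ]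
      exact ⟨rfl, rfl⟩
  have hψT := algEquiv_tP (pow_ne_zero 2 hc) hψt
  have hφT := algEquiv_tP (pow_ne_zero 2 hξ0) hφt
  have hφord : orderOf φp = 2 * k := by
    rw [orderOf_eq_iff (by omega)]
    refine ⟨hypRing_algEquiv_ext ?_ ?_, fun m hm hm0 h => ?_⟩
    · rw [(hφpow _).1, ← pow_mul, mul_comm 2, pow_mul, hξprim.pow_eq_one, one_pow, one_smul,
        AlgEquiv.one_apply]
    · rw [(hφpow _).2, hξprim.pow_eq_one, one_smul, AlgEquiv.one_apply]
    · have h2 := (hφpow m).2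
      rw [h, AlgEquiv.one_apply] at h2
      have h3 : (ξ ^ m - 1) • uE p = 0 := by rw [sub_smul, one_smul, ← h2, sub_self]
      rcases smul_eq_zero.1 h3 with h4 | h4
      · exact hξprim.pow_ne_one_of_pos_of_lt hm0.ne' hm (sub_eq_zero.1 h4)
      · exact uE_ne_zero p h4
  have hψsq : ψp ^ 2 = 1 := by
    refine hypRing_algEquiv_ext ?_ ?_
    · rw [sq ψp, AlgEquiv.mul_apply, hψt, map_smul, hψT, smul_smul, AlgEquiv.one_apply, zpow_neg_one,
        mul_inv_cancel₀ (pow_ne_zero 2 hc), one_smul]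
      rfl
    · rw [sq ψp, AlgEquiv.mul_apply, hψu, map_smul, map_mul, hψT, hψu, smul_mul_smul_comm, smul_smul,
        ← mul_assoc (tP p _), ← tP_add, AlgEquiv.one_apply]
      have e1 : (-1 : ℤ) * (-(n : ℤ) - 1) + (-(n : ℤ) - 1) = 0 := by ring
      have e2 : c ^ (n + 1) * ((c ^ 2) ^ (-(n : ℤ) - 1) * c ^ (n + 1)) = 1 := by
        rw [show -(n : ℤ) - 1 = -((n + 1 : ℕ) : ℤ) by push_cast; ring, zpow_neg, zpow_natCast]
        field_simp
        ring
      rw [e1, e2, tP_zero, one_mul, one_smul]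
  have hψinv : ψp⁻¹ = ψp := inv_eq_of_mul_eq_one_left (by rw [← sq ψp, hψsq])
  have hnot : ψp ∉ Subgroup.zpowers φp := by
    intro hmem
    have hfin : IsOfFinOrder φp := orderOf_pos_iff.1 (by omega)
    obtain ⟨m, hm⟩ := hfin.mem_powers_iff_mem_zpowers.2 hmem
    have h1 := (hφpow m).1
    rw [show φp ^ m = ψp from hm, hψt] at h1
    have h2 : c ^ 2 • (LaurentPolynomial.T (-1) : LaurentPolynomial ℂ) =
        (ξ ^ 2) ^ m • LaurentPolynomial.T 1 := by
      apply hypRing_of_injective p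
      have hsmul : ∀ (a : ℂ) (q : LaurentPolynomial ℂ),
          AdjoinRoot.of (Polynomial.X ^ 2 - Polynomial.C p) (a • q) =
            a • AdjoinRoot.of (Polynomial.X ^ 2 - Polynomial.C p) q := fun a q =>
        by
        rw [Algebra.smul_def, map_mul, Algebra.smul_def]; rfl
      rw [hsmul, hsmul]
      exact h1
    have h3 := congrArg (fun q : LaurentPolynomial ℂ => q.coeff (-1)) h2
    exact hc (by simpa [LaurentPolynomial.T_apply] using h3)
  have hψord : orderOf ψp = 2 :=
    orderOf_eq_prime hψsq fun h => hnot (h ▸ Subgroup.one_mem _)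
  have hconjt : (ψp * φp * ψp⁻¹) (tP p 1) = (ξ ^ 2)⁻¹ • tP p 1 := by
    rw [hψinv, AlgEquiv.mul_apply, AlgEquiv.mul_apply, hψt, map_smul, hφT, map_smul, map_smul, hψT,
      smul_smul, smul_smul]
    congr 1
    simp only [one_mul, zpow_neg_one]
    field_simp
  have hconju : (ψp * φp * ψp⁻¹) (uE p) = ((ξ ^ (2 * n))⁻¹ * ξ⁻¹) • uE p := by
    have h1 : φp (ψp (uE p)) = ((ξ ^ (2 * n))⁻¹ * ξ⁻¹) • ψp (uE p) := by
      rw [hψu, map_smul, map_mul, hφT, hφu, smul_mul_smul_comm, smul_smul, smul_smul, one_mul]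
      congr 1
      rw [show -(n : ℤ) - 1 = -((n + 1 : ℕ) : ℤ) by push_cast; ring, zpow_neg, zpow_natCast]
      field_simp
      ring
    rw [hψinv, AlgEquiv.mul_apply, AlgEquiv.mul_apply, h1, map_smul, ← AlgEquiv.mul_apply, ← sq ψp,
      hψsq, AlgEquiv.one_apply]
  have hξk : ξ ^ k = -1 := by
    have h1 : ξ ^ k * ξ ^ k = 1 := by rw [← pow_add, ← two_mul, hξprim.pow_eq_one]
    rcases mul_self_eq_one_iff.1 h1 with h | h
    · exact absurd h (hξprim.pow_ne_one_of_pos_of_lt (by omega) (by omega))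
    · exact h
  have hξ2n : ξ ^ (2 * n) = (-1) ^ l := by rw [← hl, pow_mul, hξk]
  refine ⟨fun hle => ?_, fun hlo => ?_⟩
  · have hconj : ψp * φp * ψp⁻¹ = φp⁻¹ := by
      rw [eq_inv_iff_mul_eq_one]
      refine hypRing_algEquiv_ext ?_ ?_
      · rw [AlgEquiv.mul_apply, hφt, map_smul, hconjt, smul_smul,
          mul_inv_cancel₀ (pow_ne_zero 2 hξ0), one_smul, AlgEquiv.one_apply]
      · rw [AlgEquiv.mul_apply, hφu, map_smul, hconju, smul_smul, hξ2n, hle.neg_one_pow, inv_one,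
          one_mul, mul_inv_cancel₀ hξ0, one_smul, AlgEquiv.one_apply]
    exact ⟨hψord, hφord, hconj,
      nonempty_closure_pair_mulEquiv_dihedralGroup hψsq hφord hconj hnot⟩
  · have hξk1 : ξ ^ (k - 1) * ξ = -1 := by rw [← pow_succ, Nat.sub_add_cancel hk, hξk]
    have hconj : ψp * φp * ψp⁻¹ = φp ^ (k - 1) := by
      refine hypRing_algEquiv_ext ?_ ?_
      · rw [hconjt, (hφpow _).1]
        congr 1
        refine inv_eq_of_mul_eq_one_left ?_
        rw [← pow_mul, mul_comm 2, pow_mul, ← mul_pow, hξk1]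
        norm_num
      · rw [hconju, (hφpow _).2, hξ2n, hlo.neg_one_pow]
        congr 1
        rw [← mul_inv]
        refine inv_eq_of_mul_eq_one_left ?_
        linear_combination -hξk1
    refine ⟨hconj, Subgroup.normal_subgroupOf_of_le_normalizer
      (closure_pair_le_normalizer_zpowers hψsq (hconj ▸ Subgroup.npow_mem_zpowers φp _)),
      nonempty_closure_pair_mulEquiv_UGroup hψsq hφord ?_ hnot⟩
    rw [hψinv] at hconj
    rw [hconj, ← pow_add, show k - 1 + (k + 1) = 2 * k by omega, ← hφord, pow_orderOf_eq_one]

end
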